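/- Let w and z be real numbers with 0 ≤ w < z. Then 1/(z − w) = Σ_{n=0}^∞ (w(w+1)⋯(w+n−1))/(z(z+1)⋯(z+n)), where the empty product in the numerator for n = 0 equals 1. -/

import Mathlib

open Filter Topology in
/-- The ratio `w^{(n)} / z^{(n)}` of rising factorials tends to `0` when `0 ≤ w < z`. -/
theorem tendsto_prod_add_div_prod_add_zero {w z : ℝ} (hw : 0 ≤ w) (hwz : w < z) :
    Tendsto (fun n : ℕ => ∏ i ∈ Finset.range n, (w + (i : ℝ)) / (z + (i : ℝ))) atTop (𝓝 0) := by
  have hz : 0 < z := hw.trans_lt hwz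
  set c : ℝ := (z - w) / (z + 1) with hc
  have hc0 : 0 < c := div_pos (sub_pos.2 hwz) (by linarith)
  have factor_le (i : ℕ) :
      (w + (i : ℝ)) / (z + (i : ℝ)) ≤ Real.exp (-(c * (1 / ((i : ℝ) + 1)))) := by
    have hi : (0 : ℝ) ≤ i := i.cast_nonneg
    have hle : c * (1 / ((i : ℝ) + 1)) ≤ (z - w) / (z + i) := by
      rw [hc, div_mul_div_comm, mul_one]
      exact div_le_div_of_nonneg_left (sub_pos.2 hwz).le (by linarith) (by nlinarith)
    have heq : (w + (i : ℝ)) / (z + i) = 1 - (z - w) / (z + i) := by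
      have : z + (i : ℝ) ≠ 0 := by positivity
      field_simp
      ring
    linarith [Real.add_one_le_exp (-(c * (1 / ((i : ℝ) + 1))))]
  refine squeeze_zero
    (g := fun n : ℕ => Real.exp (-(c * ∑ i ∈ Finset.range n, 1 / ((i : ℝ) + 1))))
    (fun n => Finset.prod_nonneg fun i _ => by positivity) (fun n => ?_) ?_
  · rw [Finset.mul_sum, ← Finset.sum_neg_distrib, Real.exp_sum]
    exact Finset.prod_le_prod (fun i _ => by positivity) fun i _ => factor_le i
  · exact Real.tendsto_exp_neg_atTop_nhds_zero.comp
      (Real.tendsto_sum_range_one_div_nat_succ_atTop.const_mul_atTop hc0)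

/-- The partial sums of the inverse factorial series of `1 / (z - w)`. -/
theorem sum_range_prod_add_div_prod_add {w z : ℝ} (hz : 0 < z) (hwz : w ≠ z) (N : ℕ) :
    ∑ n ∈ Finset.range N,
        (∏ i ∈ Finset.range n, (w + (i : ℝ))) / ∏ i ∈ Finset.range (n + 1), (z + (i : ℝ)) =
      (1 - ∏ i ∈ Finset.range N, (w + (i : ℝ)) / (z + (i : ℝ))) / (z - w) := by
  have hsub : z - w ≠ 0 := sub_ne_zero.2 hwz.symm
  induction N with
  | zero => simp
  | succ N ih =>
    have hN : z + (N : ℝ) ≠ 0 := by positivity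
    have hP : ∏ i ∈ Finset.range N, (z + (i : ℝ)) ≠ 0 :=
      Finset.prod_ne_zero_iff.2 fun i _ => by positivity
    rw [Finset.sum_range_succ, ih, Finset.prod_range_succ, Finset.prod_range_succ,
      Finset.prod_div_distrib]
    field_simp
    ring

/-- Nørlund inverse factorial expansion: for real `0 ≤ w < z`,
`1/(z-w) = ∑_{n=0}^∞ (w(w+1)⋯(w+n-1))/(z(z+1)⋯(z+n))`, the empty product in the
numerator for `n = 0` being `1`. -/
theorem inverse_factorial_expansion (w z : ℝ) (hw : 0 ≤ w) (hwz : w < z) :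
    HasSum (fun n : ℕ =>
        (∏ i ∈ Finset.range n, (w + (i : ℝ))) /
          ∏ i ∈ Finset.range (n + 1), (z + (i : ℝ)))
      (1 / (z - w)) := by
  have hz : 0 < z := hw.trans_lt hwz
  rw [hasSum_iff_tendsto_nat_of_nonneg fun n => div_nonneg
    (Finset.prod_nonneg fun i _ => by positivity) (Finset.prod_nonneg fun i _ => by positivity)]
  simp_rw [sum_range_prod_add_div_prod_add hz hwz.ne]
  simpa using ((tendsto_prod_add_div_prod_add_zero hw hwz).const_sub 1).div_const (z - w)
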